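/- Let p, q be real numbers with 1 < q ≤ 3 < p < ∞ and let N ≥ 1 be an integer. Then there exists a constant C > 0 (depending only on p, q, N) such that for all (s_1, …, s_N) ∈ ℝ^N one has |f'(∑_{n=1}^N s_n) − ∑_{n=1}^N f'(s_n)| ≤ C ( ∑_{n ≠ n'} |s_n|^{(q−1)/2} |s_{n'}|^{(q−1)/2} + ∑_{n ≠ n'} |s_n|^{p−2} |s_{n'}| ), where the sums ∑_{n ≠ n'} run over ordered pairs (n, n') with 1 ≤ n, n' ≤ N and n ≠ n'. -/

import Mathlib

/-- Derivative of the double power nonlinearity `f(s) = |s|^(p-1) s - |s|^(q-1) s`: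
`f'(s) = p |s|^(p-1) - q |s|^(q-1)` (real exponents). -/
noncomputable def fD' (p q s : ℝ) : ℝ := p * |s| ^ (p - 1) - q * |s| ^ (q - 1)

open Finset

/-- Mean value bound for a power with exponent at least one. -/
lemma abs_abs_rpow_sub_abs_rpow_le_of_one_le {r K x y : ℝ} (hr : 1 ≤ r) (hx : |x| ≤ K)
    (hy : |y| ≤ K) : |(|x| ^ r) - |y| ^ r| ≤ r * K ^ (r - 1) * |x - y| := by
  have h := (convex_Icc (0 : ℝ) K).norm_image_sub_le_of_norm_hasDerivWithin_le
    (f := fun t : ℝ => t ^ r) (f' := fun t : ℝ => r * t ^ (r - 1)) (C := r * K ^ (r - 1))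
    (fun t _ => (Real.hasDerivAt_rpow_const (Or.inr hr)).hasDerivWithinAt)
    (fun t ht => by
      have h0 := Real.rpow_nonneg ht.1 (r - 1)
      rw [Real.norm_of_nonneg (by positivity)]
      exact mul_le_mul_of_nonneg_left
        (Real.rpow_le_rpow ht.1 ht.2 (by linarith)) (by linarith))
    ⟨abs_nonneg y, hy⟩ ⟨abs_nonneg x, hx⟩
  have hK : 0 ≤ K := (abs_nonneg x).trans hx
  have h0 := Real.rpow_nonneg hK (r - 1)
  exact h.trans (mul_le_mul_of_nonneg_left (abs_abs_sub_abs_le_abs_sub x y) (by positivity))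

/-- The map `x ↦ |x| ^ a` is `a`-Hölder for `a ∈ [0, 1]`. -/
lemma abs_abs_rpow_sub_abs_rpow_le_of_le_one {a : ℝ} (ha : 0 ≤ a) (ha1 : a ≤ 1) (x y : ℝ) :
    |(|x| ^ a) - |y| ^ a| ≤ |x - y| ^ a := by
  have key : ∀ u v : ℝ, |u| ^ a ≤ |u - v| ^ a + |v| ^ a := fun u v => by
    refine le_trans ?_ (Real.rpow_add_le_add_rpow (abs_nonneg _) (abs_nonneg _) ha ha1)
    refine Real.rpow_le_rpow (abs_nonneg _) ?_ ha
    simpa using abs_add_le (u - v) v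
  rw [abs_sub_le_iff]
  constructor
  · linarith [key x y]
  · have := key y x
    rw [abs_sub_comm] at this
    linarith

lemma abs_abs_rpow_sub_abs_rpow_le_of_le_two {r K x y : ℝ} (hr : 0 < r) (hr2 : r ≤ 2)
    (hx : |x| ≤ K) (hy : |y| ≤ K) :
    |(|x| ^ r) - |y| ^ r| ≤ 2 * K ^ (r / 2) * |x - y| ^ (r / 2) := by
  have hsq : ∀ t : ℝ, |t| ^ r = |t| ^ (r / 2) * |t| ^ (r / 2) := fun t => by
    rw [← Real.rpow_add_of_nonneg (abs_nonneg t) (by linarith) (by linarith), add_halves]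
  have hfac : |x| ^ r - |y| ^ r =
      (|x| ^ (r / 2) + |y| ^ (r / 2)) * (|x| ^ (r / 2) - |y| ^ (r / 2)) := by
    rw [hsq, hsq]; ring
  have hx' := Real.rpow_le_rpow (abs_nonneg x) hx (by linarith : 0 ≤ r / 2)
  have hy' := Real.rpow_le_rpow (abs_nonneg y) hy (by linarith : 0 ≤ r / 2)
  rw [hfac, abs_mul, abs_of_nonneg (by positivity : 0 ≤ |x| ^ (r / 2) + |y| ^ (r / 2))]
  refine mul_le_mul (by linarith)
    (abs_abs_rpow_sub_abs_rpow_le_of_le_one (by linarith) (by linarith) x y) (abs_nonneg _) ?_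
  have : 0 ≤ |x| ^ (r / 2) := by positivity
  linarith

lemma abs_sum_rpow_le_sum_abs_rpow {ι : Type*} {a : ℝ} (ha : 0 < a) (ha1 : a ≤ 1)
    (t : Finset ι) (s : ι → ℝ) : |∑ n ∈ t, s n| ^ a ≤ ∑ n ∈ t, |s n| ^ a := by
  classical
  induction t using Finset.induction_on with
  | empty => simp [Real.zero_rpow ha.ne']
  | insert i t hi ih =>
    rw [sum_insert hi, sum_insert hi]
    calc |s i + ∑ n ∈ t, s n| ^ a ≤ (|s i| + |∑ n ∈ t, s n|) ^ a :=
          Real.rpow_le_rpow (abs_nonneg _) (abs_add_le _ _) ha.le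
      _ ≤ |s i| ^ a + |∑ n ∈ t, s n| ^ a :=
          Real.rpow_add_le_add_rpow (abs_nonneg _) (abs_nonneg _) ha.le ha1
      _ ≤ _ := by gcongr

section MaximalTerm

variable {ι : Type*} [Fintype ι] {s : ι → ℝ} {m : ι}

lemma abs_sum_le_card_mul (hm : ∀ n, |s n| ≤ |s m|) :
    |∑ n, s n| ≤ Fintype.card ι * |s m| := by
  refine (abs_sum_le_sum_abs _ _).trans ((sum_le_sum fun n _ => hm n).trans ?_)
  simp

lemma abs_le_card_mul (s : ι → ℝ) (m : ι) : |s m| ≤ Fintype.card ι * |s m| := by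
  have : (1 : ℝ) ≤ Fintype.card ι := by
    exact_mod_cast Fintype.card_pos_iff.2 ⟨m⟩
  exact le_mul_of_one_le_left (abs_nonneg _) this

variable [DecidableEq ι]

lemma abs_rpow_sum_sub_sum_rpow_le_of_le_two {r : ℝ} (hr : 0 < r) (hr2 : r ≤ 2)
    (hm : ∀ n, |s n| ≤ |s m|) :
    |(|∑ n, s n| ^ r) - ∑ n, |s n| ^ r| ≤
      (2 * (Fintype.card ι : ℝ) ^ (r / 2) + 1) *
        ∑ n ∈ univ.erase m, |s m| ^ (r / 2) * |s n| ^ (r / 2) := by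
  have hS : ∑ n, s n - s m = ∑ n ∈ univ.erase m, s n := by
    rw [← add_sum_erase univ s (mem_univ m)]; ring
  have h1 := abs_abs_rpow_sub_abs_rpow_le_of_le_two hr hr2 (abs_sum_le_card_mul hm)
    (abs_le_card_mul s m)
  rw [hS, Real.mul_rpow (by positivity) (abs_nonneg _)] at h1
  have h2 : ∑ n ∈ univ.erase m, |s n| ^ r ≤
      ∑ n ∈ univ.erase m, |s m| ^ (r / 2) * |s n| ^ (r / 2) := by
    refine sum_le_sum fun n _ => ?_
    calc |s n| ^ r = |s n| ^ (r / 2) * |s n| ^ (r / 2) := by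
          rw [← Real.rpow_add_of_nonneg (abs_nonneg _) (by linarith) (by linarith), add_halves]
      _ ≤ _ := mul_le_mul_of_nonneg_right
          (Real.rpow_le_rpow (abs_nonneg _) (hm n) (by linarith)) (by positivity)
  have h3 : 2 * ((Fintype.card ι : ℝ) ^ (r / 2) * |s m| ^ (r / 2)) *
      |∑ n ∈ univ.erase m, s n| ^ (r / 2) ≤ 2 * (Fintype.card ι : ℝ) ^ (r / 2) *
        ∑ n ∈ univ.erase m, |s m| ^ (r / 2) * |s n| ^ (r / 2) := by
    rw [← mul_sum, ← mul_assoc, ← mul_assoc]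
    exact mul_le_mul_of_nonneg_left
      (abs_sum_rpow_le_sum_abs_rpow (by linarith) (by linarith) _ _) (by positivity)
  have h4 : 0 ≤ ∑ n ∈ univ.erase m, |s n| ^ r := sum_nonneg fun n _ => by positivity
  rw [← add_sum_erase univ (fun n => |s n| ^ r) (mem_univ m)]
  rw [abs_le] at h1 ⊢
  constructor <;> linarith [h1.1, h1.2]

lemma abs_rpow_sum_sub_sum_rpow_le_of_one_le {r : ℝ} (hr : 1 ≤ r)
    (hm : ∀ n, |s n| ≤ |s m|) :
    |(|∑ n, s n| ^ r) - ∑ n, |s n| ^ r| ≤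
      (r * (Fintype.card ι : ℝ) ^ (r - 1) + 1) *
        ∑ n ∈ univ.erase m, |s m| ^ (r - 1) * |s n| := by
  have hS : ∑ n, s n - s m = ∑ n ∈ univ.erase m, s n := by
    rw [← add_sum_erase univ s (mem_univ m)]; ring
  have h1 := abs_abs_rpow_sub_abs_rpow_le_of_one_le hr (abs_sum_le_card_mul hm)
    (abs_le_card_mul s m)
  rw [hS, Real.mul_rpow (by positivity) (abs_nonneg _)] at h1
  have h2 : ∑ n ∈ univ.erase m, |s n| ^ r ≤
      ∑ n ∈ univ.erase m, |s m| ^ (r - 1) * |s n| := by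
    refine sum_le_sum fun n _ => ?_
    calc |s n| ^ r = |s n| ^ (r - 1) * |s n| := by
          rw [← Real.rpow_add_one' (abs_nonneg _) (by linarith), sub_add_cancel]
      _ ≤ _ := mul_le_mul_of_nonneg_right
          (Real.rpow_le_rpow (abs_nonneg _) (hm n) (by linarith)) (by positivity)
  have h3 : r * ((Fintype.card ι : ℝ) ^ (r - 1) * |s m| ^ (r - 1)) *
      |∑ n ∈ univ.erase m, s n| ≤ r * (Fintype.card ι : ℝ) ^ (r - 1) *
        ∑ n ∈ univ.erase m, |s m| ^ (r - 1) * |s n| := by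
    rw [← mul_sum, ← mul_assoc, ← mul_assoc]
    exact mul_le_mul_of_nonneg_left (abs_sum_le_sum_abs _ _) (by positivity)
  have h4 : 0 ≤ ∑ n ∈ univ.erase m, |s n| ^ r := sum_nonneg fun n _ => by positivity
  rw [← add_sum_erase univ (fun n => |s n| ^ r) (mem_univ m)]
  rw [abs_le] at h1 ⊢
  constructor <;> linarith [h1.1, h1.2]

lemma sum_erase_le_sum_sum_ite {w : ι → ι → ℝ} (hw : ∀ i j, 0 ≤ w i j) (m : ι) :
    ∑ n ∈ univ.erase m, w m n ≤ ∑ n, ∑ n', if n = n' then 0 else w n n' := by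
  have h0 : ∀ i j, 0 ≤ if i = j then 0 else w i j := fun i j => by
    split_ifs
    exacts [le_rfl, hw i j]
  calc ∑ n ∈ univ.erase m, w m n = ∑ n ∈ univ.erase m, if m = n then 0 else w m n :=
        sum_congr rfl fun n hn => (if_neg (ne_of_mem_erase hn).symm).symm
    _ ≤ ∑ n, if m = n then 0 else w m n :=
        sum_le_sum_of_subset_of_nonneg (erase_subset _ _) fun n _ _ => h0 m n
    _ ≤ _ := single_le_sum (f := fun i => ∑ j, if i = j then 0 else w i j)
        (fun i _ => sum_nonneg fun j _ => h0 i j) (mem_univ m)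

end MaximalTerm

theorem df_pointwise_q_le_three_lt_p (p q : ℝ) (hq : 1 < q) (hq3 : q ≤ 3) (hp3 : 3 < p)
    (N : ℕ) (hN : 1 ≤ N) :
    ∃ C > 0, ∀ s : Fin N → ℝ,
      |fD' p q (∑ n, s n) - ∑ n, fD' p q (s n)| ≤
        C * ((∑ n, ∑ n', if n = n' then 0 else
                |s n| ^ ((q - 1) / 2) * |s n'| ^ ((q - 1) / 2)) +
             (∑ n, ∑ n', if n = n' then 0 else
                |s n| ^ (p - 2) * |s n'|)) := by
  have hp1 : 0 < p - 1 := by linarith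
  set A : ℝ := q * (2 * (N : ℝ) ^ ((q - 1) / 2) + 1) with hA
  set B : ℝ := p * ((p - 1) * (N : ℝ) ^ (p - 1 - 1) + 1) with hB
  have hA0 : 0 < A := by positivity
  have hB0 : 0 < B := by positivity
  refine ⟨A + B, by positivity, fun s => ?_⟩
  have : Nonempty (Fin N) := ⟨⟨0, hN⟩⟩
  obtain ⟨m, hm⟩ := Finite.exists_max fun n => |s n|
  have h1 := abs_rpow_sum_sub_sum_rpow_le_of_le_two (r := q - 1) (by linarith) (by linarith) hm
  have h2 := abs_rpow_sum_sub_sum_rpow_le_of_one_le (r := p - 1) (by linarith) hm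
  have h3 := sum_erase_le_sum_sum_ite
    (w := fun i j => |s i| ^ ((q - 1) / 2) * |s j| ^ ((q - 1) / 2)) (fun i j => by positivity) m
  have h4 := sum_erase_le_sum_sum_ite
    (w := fun i j => |s i| ^ (p - 2) * |s j|) (fun i j => by positivity) m
  have h5 : 0 ≤ ∑ n ∈ univ.erase m, |s m| ^ ((q - 1) / 2) * |s n| ^ ((q - 1) / 2) :=
    sum_nonneg fun n _ => by positivity
  have h6 : 0 ≤ ∑ n ∈ univ.erase m, |s m| ^ (p - 2) * |s n| :=
    sum_nonneg fun n _ => by positivity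
  simp only [Fintype.card_fin] at h1 h2
  have hp2 : p - 1 - 1 = p - 2 := by ring
  rw [hp2] at h2 hB
  set X := ∑ n, ∑ n', if n = n' then 0 else |s n| ^ ((q - 1) / 2) * |s n'| ^ ((q - 1) / 2)
  set Y := ∑ n, ∑ n', if n = n' then 0 else |s n| ^ (p - 2) * |s n'|
  have hsplit : fD' p q (∑ n, s n) - ∑ n, fD' p q (s n) =
      p * (|∑ n, s n| ^ (p - 1) - ∑ n, |s n| ^ (p - 1)) -
        q * (|∑ n, s n| ^ (q - 1) - ∑ n, |s n| ^ (q - 1)) := by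
    simp only [fD', sum_sub_distrib, ← mul_sum]
    ring
  have hX : 0 ≤ X := h5.trans h3
  have hY : 0 ≤ Y := h6.trans h4
  rw [hsplit]
  calc _ ≤ p * |(|∑ n, s n| ^ (p - 1)) - ∑ n, |s n| ^ (p - 1)| +
        q * |(|∑ n, s n| ^ (q - 1)) - ∑ n, |s n| ^ (q - 1)| := by
        refine (abs_sub _ _).trans ?_
        rw [abs_mul, abs_mul, abs_of_pos (by linarith : 0 < p), abs_of_pos (by linarith : 0 < q)]
    _ ≤ B * Y + A * X := by
        rw [hA, hB, mul_assoc, mul_assoc]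
        refine add_le_add (mul_le_mul_of_nonneg_left (h2.trans ?_) (by linarith))
          (mul_le_mul_of_nonneg_left (h1.trans ?_) (by linarith))
        · exact mul_le_mul_of_nonneg_left h4 (by positivity)
        · exact mul_le_mul_of_nonneg_left h3 (by positivity)
    _ ≤ (A + B) * (X + Y) := by nlinarith [mul_nonneg hA0.le hY, mul_nonneg hB0.le hX]
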